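/- arXiv:2602.19673 — 2 statements merged into one kernel-verified Lean document; each statement's English description precedes it below -/
import Mathlib

section
/- Let σ and σ' be first-order vocabularies with σ ⊆ σ', let Γ be a set of first-order sentences over σ', let ψ(x̄) be a first-order formula over σ' with free variables among x̄, and assume Γ has at least one model. Then the following are equivalent: (i) there exist two models 𝒜 and ℬ of Γ whose reducts to σ are equal, and a tuple ā of elements of 𝒜 such that 𝒜 ⊨ ψ(ā) holds if and only if ℬ ⊨ ψ(ā) does not hold; (ii) there exists no first-order formula φ(x̄) over σ that is equivalent to ψ(x̄) on all models of Γ (i.e., no σ-formula φ such that for every model 𝒮 of Γ and every tuple ā, 𝒮 ⊨ ψ(ā) ⟺ 𝒮 ⊨ φ(ā)). -/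
open FirstOrder Language

universe u v w

namespace FirstOrder.Language

open Filter Structure

section Ultraproduct

variable {K : Language.{u, v}} {J : Type*} {β : Type*}

/-- The ultraproduct, along an ultrafilter containing all final segments of the finite subsets
of `J`, realizes each formula that is realized in all sufficiently late factors. -/
theorem realize_product_of_atTop (M : Finset J → Type*) [∀ F, K.Structure (M F)]
    [∀ F, Nonempty (M F)] (a : ∀ F, β → M F) (q : K.Formula β) (F₀ : Finset J)
    (h : ∀ F, F₀ ⊆ F → q.Realize (a F)) :
    q.Realize (fun b => ((fun F => a F b : ∀ F, M F) :
      ((Ultrafilter.of atTop : Ultrafilter (Finset J)) : Filter (Finset J)).Product M)) := by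
  rw [Ultraproduct.realize_formula_cast]
  exact Ultrafilter.of_le _ ((eventually_ge_atTop F₀).mono h)

/-- Compactness for formulas with free variables, with control over the universe of the model. -/
theorem exists_realize_of_finite {K : Language.{u, v}} {J : Type (max u v)} (Γ : K.Theory)
    (θ : K.Formula β) (q : J → K.Formula β)
    (h : ∀ F : Finset J, ∃ (M : Theory.ModelType.{u, v, max u v} Γ) (a : β → M),
      θ.Realize a ∧ ∀ i ∈ F, (q i).Realize a) :
    ∃ (M : Theory.ModelType.{u, v, max u v} Γ) (a : β → M),
      θ.Realize a ∧ ∀ i, (q i).Realize a := by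
  choose M a hθ hq using h
  let P := ((Ultrafilter.of atTop : Ultrafilter (Finset J)) : Filter (Finset J)).Product
    (fun F => (M F : Type (max u v)))
  have hP : P ⊨ Γ := by
    refine ⟨fun χ hχ => ?_⟩
    rw [Ultraproduct.sentence_realize]
    exact Eventually.of_forall fun F => (M F).is_model.realize_of_mem χ hχ
  have : Nonempty P := Ultraproduct.Product.instNonempty
  refine ⟨Theory.ModelType.of Γ P, fun b => ((fun F => a F b : ∀ F, M F) : P), ?_, fun i => ?_⟩
  · exact realize_product_of_atTop (fun F => (M F : Type (max u v))) a θ ∅ fun F _ => hθ F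
  · exact realize_product_of_atTop (fun F => (M F : Type (max u v))) a (q i) {i}
      fun F hF => hq F i (hF (Finset.mem_singleton_self i))

end Ultraproduct

section Reduct

variable {L L' : Language.{u, v}} (φ : L →ᴸ L')

theorem realize_onFormula_reduct {β M : Type*} [S : L'.Structure M] (χ : L.Formula β) (x : β → M) :
    (φ.onFormula χ).Realize x ↔ @Formula.Realize L M (φ.reduct M) β χ x := by
  let := φ.reduct M
  exact LHom.realize_onFormula φ χ

theorem realize_onFormula_not {β M : Type*} [L'.Structure M] (χ : L.Formula β) (x : β → M) :
    (φ.onFormula χ.not).Realize x ↔ ¬ (φ.onFormula χ).Realize x := by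
  let := φ.reduct M
  simp only [realize_onFormula_reduct, Formula.realize_not]

theorem realize_onFormula_relabel {β γ M : Type*} [L'.Structure M] (χ : L.Formula β) (g : β → γ)
    (x : γ → M) :
    (φ.onFormula (χ.relabel g)).Realize x ↔ (φ.onFormula χ).Realize (x ∘ g) := by
  let := φ.reduct M
  simp only [realize_onFormula_reduct, Formula.realize_relabel]

theorem realize_onFormula_iInf {β γ M : Type*} [L'.Structure M] [Finite γ] (χ : γ → L.Formula β)
    (x : β → M) :
    (φ.onFormula (Formula.iInf χ)).Realize x ↔ ∀ i, (φ.onFormula (χ i)).Realize x := by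
  let := φ.reduct M
  simp only [realize_onFormula_reduct, Formula.realize_iInf]

/-- The tuples `a` and `b` have the same type in the language `L`. -/
def SameType {ι A B : Type*} [L'.Structure A] [L'.Structure B] (a : ι → A) (b : ι → B) : Prop :=
  ∀ χ : L.Formula ι, (φ.onFormula χ).Realize a ↔ (φ.onFormula χ).Realize b

variable {φ}

theorem sameType_of_imp {ι A B : Type*} [L'.Structure A] [L'.Structure B] {a : ι → A} {b : ι → B}
    (h : ∀ χ : L.Formula ι, (φ.onFormula χ).Realize a → (φ.onFormula χ).Realize b) :
    SameType φ a b := by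
  refine fun χ => ⟨h χ, fun hb => ?_⟩
  by_contra ha
  exact (realize_onFormula_not φ χ b).1 (h χ.not ((realize_onFormula_not φ χ a).2 ha)) hb

theorem SameType.symm {ι A B : Type*} [L'.Structure A] [L'.Structure B] {a : ι → A} {b : ι → B}
    (h : SameType φ a b) : SameType φ b a :=
  fun χ => (h χ).symm

theorem SameType.comp {ι κ A B : Type*} [L'.Structure A] [L'.Structure B] {a : ι → A} {b : ι → B}
    (h : SameType φ a b) (g : κ → ι) : SameType φ (a ∘ g) (b ∘ g) := fun χ => by
  simpa only [realize_onFormula_relabel] using h (χ.relabel g)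

theorem SameType.eq_of_eq {ι A B : Type*} [L'.Structure A] [L'.Structure B] {a : ι → A} {b : ι → B}
    (h : SameType φ a b) {i j : ι} (hij : a i = a j) : b i = b j := by
  let := φ.reduct A
  let := φ.reduct B
  have := h ((Term.var i).equal (Term.var j))
  simp only [realize_onFormula_reduct, Formula.realize_equal, Term.realize_var] at this
  exact this.1 hij

/-- If `a` and `b` have the same type, every formula true of `B` can be realized in `A` by an
assignment sending `b i` to `a i`. -/
theorem SameType.exists_assignment {ι A B : Type*} [L'.Structure A] [L'.Structure B] [Nonempty A]
    {a : ι → A} {b : ι → B} (h : SameType φ b a) (χ : L.Formula B)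
    (hχ : (φ.onFormula χ).Realize (id : B → B)) :
    ∃ k : B → A, (φ.onFormula χ).Realize k ∧ ∀ i, k (b i) = a i := by
  classical
  let := φ.reduct A
  let := φ.reduct B
  let s := χ.freeVarFinset
  let r : s → ι ⊕ s := fun x => if hx : ∃ i, b i = x then Sum.inl hx.choose else Sum.inr x
  let ρ : L.Formula (ι ⊕ s) := BoundedFormula.restrictFreeVar χ r
  have hB : (φ.onFormula (ρ.iExs s)).Realize b := by
    rw [realize_onFormula_reduct, Formula.realize_iExs]
    refine ⟨fun x => x, ?_⟩
    rw [realize_onFormula_reduct] at hχ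
    refine (BoundedFormula.realize_restrictFreeVar id fun x => ?_).2 hχ
    by_cases hx : ∃ i, b i = x
    · simpa [r, hx] using hx.choose_spec
    · simp [r, hx]
  have hA := (h _).1 hB
  rw [realize_onFormula_reduct, Formula.realize_iExs] at hA
  obtain ⟨w, hw⟩ := hA
  let k : B → A := fun y => if hy : ∃ i, b i = y then a hy.choose else
    if hs : y ∈ s then w ⟨y, hs⟩ else Classical.arbitrary A
  refine ⟨k, ?_, fun i => ?_⟩
  · rw [realize_onFormula_reduct]
    refine (BoundedFormula.realize_restrictFreeVar k fun x => ?_).1 hw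
    by_cases hx : ∃ i, b i = x
    · simp [r, k, hx]
    · simp [r, k, hx]
  · have hy : ∃ j, b j = b i := ⟨i, rfl⟩
    simp only [k, dif_pos hy]
    exact h.eq_of_eq hy.choose_spec

/-- Tuples of the same `L`-type can be identified in an elementary extension of one structure,
into which the other one embeds `L`-elementarily. -/
theorem SameType.exists_extension {ι : Type*} {A B : Type (max u v)} [L'.Structure A]
    [L'.Structure B] [Nonempty A] {a : ι → A} {b : ι → B} (h : SameType φ b a) :
    ∃ (C : Type (max u v)) (_ : L'.Structure C) (g : A ↪ₑ[L'] C) (k : B → C),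
      SameType φ (id : B → B) k ∧ ∀ i, k (b i) = g (a i) := by
  let J := {χ : L.Formula B // (φ.onFormula χ).Realize (id : B → B)}
  have hF : ∀ F : Finset J, ∃ k : B → A, (∀ χ ∈ F, (φ.onFormula χ.1).Realize k) ∧
      ∀ i, k (b i) = a i := by
    intro F
    obtain ⟨k, hk, hk'⟩ := h.exists_assignment (Formula.iInf fun χ : F => χ.1.1)
      ((realize_onFormula_iInf φ _ _).2 fun χ => χ.1.2)
    exact ⟨k, fun χ hχ => (realize_onFormula_iInf φ _ _).1 hk ⟨χ, hχ⟩, hk'⟩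
  choose k hk hkb using hF
  let P := ((Ultrafilter.of atTop : Ultrafilter (Finset J)) : Filter (Finset J)).Product
    (fun _ => A)
  refine ⟨P, inferInstance, ⟨fun x => ((fun _ => x : Finset J → A) : P), fun n χ x => ?_⟩,
    fun y => ((fun F => k F y : Finset J → A) : P), sameType_of_imp fun χ hχ => ?_, fun i => ?_⟩
  · refine (Ultraproduct.realize_formula_cast χ fun i _ => x i).trans ?_
    exact eventually_const
  · exact realize_product_of_atTop (fun _ => A) k (φ.onFormula χ) {⟨χ, hχ⟩}
      fun F hF => hk F _ (hF (Finset.mem_singleton_self _))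
  · exact congrArg (fun f : Finset J → A => (f : P)) (funext fun F => hkb F i)

end Reduct

section Elementary

variable {K : Language.{u, v}}

variable (K) in
/-- The map `f` underlies an elementary embedding. -/
def IsElementary {A B : Type*} [K.Structure A] [K.Structure B] (f : A → B) : Prop :=
  ∃ e : A ↪ₑ[K] B, ∀ x, e x = f x

theorem IsElementary.realize_iff {A B : Type*} {_ : K.Structure A} {_ : K.Structure B} {f : A → B}
    (h : IsElementary K f) {β : Type*} (χ : K.Formula β) (x : β → A) :
    χ.Realize (f ∘ x) ↔ χ.Realize x := by
  obtain ⟨e, he⟩ := h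
  obtain rfl : ⇑e = f := funext he
  exact e.map_formula χ x

theorem IsElementary.model {A B : Type*} {_ : K.Structure A} {_ : K.Structure B} {f : A → B}
    (h : IsElementary K f) {T : K.Theory} (hA : A ⊨ T) : B ⊨ T := by
  obtain ⟨e, -⟩ := h
  exact (e.theory_model_iff T).1 hA

theorem IsElementary.comp_embedding {A B C : Type*} {_ : K.Structure A} {_ : K.Structure B}
    {_ : K.Structure C} {f : B → C} (h : IsElementary K f) (g : A ↪ₑ[K] B) :
    IsElementary K (f ∘ g) := by
  obtain ⟨e, he⟩ := h
  exact ⟨e.comp g, fun x => he (g x)⟩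

end Elementary

section Chain

theorem exists_sequential_limit (X : ℕ → Type w) (f : ∀ n, X n → X (n + 1))
    (hf : ∀ n, Function.Injective (f n)) :
    ∃ (M : Type w) (j : ∀ n, X n → M), (∀ n, Function.Injective (j n)) ∧
      (∀ n x, j (n + 1) (f n x) = j n x) ∧ ∀ z, ∃ n x, j n x = z := by
  let : ∀ n, Language.empty.Structure (X n) := fun _ => Language.emptyStructure
  let e : ∀ n, X n ↪[Language.empty] X (n + 1) := fun n =>
    { toFun := f n, inj' := hf n, map_fun' := fun F => isEmptyElim F,
      map_rel' := fun R => isEmptyElim R }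
  let E := DirectedSystem.natLERec e
  refine ⟨DirectLimit X E, fun n => DirectLimit.of Language.empty ℕ X E n,
    fun n => (DirectLimit.of Language.empty ℕ X E n).injective, fun n x => ?_,
    DirectLimit.exists_of⟩
  have h : E n (n + 1) n.le_succ x = f n x := by
    simp only [E, DirectedSystem.coe_natLERec, Nat.leRecOn_succ']
    rfl
  rw [← h]
  exact DirectLimit.of_f

variable {Y : ℕ → Type w} {M : Type w} {j : ∀ n, Y n → M}

theorem exists_tuple_of_limit {f : ∀ n, Y n → Y (n + 1)}
    (hj : ∀ n x, j (n + 1) (f n x) = j n x) (hs : ∀ z, ∃ n x, j n x = z)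
    {k : ℕ} (x : Fin k → M) : ∃ n, ∃ y : Fin k → Y n, j n ∘ y = x := by
  have hmono : Monotone fun n => Set.range (j n) := monotone_nat_of_le_succ fun n => by
    rintro _ ⟨y, rfl⟩
    exact ⟨f n y, hj n y⟩
  choose N y hy using fun i => hs (x i)
  have hx : ∀ i, x i ∈ Set.range (j (Finset.univ.sup N)) := fun i =>
    hmono (Finset.le_sup (Finset.mem_univ i)) ⟨y i, hy i⟩
  choose z hz using hx
  exact ⟨_, z, funext hz⟩

/-- Tarski's elementary chain theorem, on a prescribed limit set. -/
theorem exists_structure_of_elementary_chain {K : Language.{u, v}} [∀ n, K.Structure (Y n)]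
    (g : ∀ n, Y n ↪ₑ[K] Y (n + 1)) (hinj : ∀ n, Function.Injective (j n))
    (hj : ∀ n x, j (n + 1) (g n x) = j n x) (hs : ∀ z, ∃ n x, j n x = z) :
    ∃ _ : K.Structure M, ∀ n, IsElementary K (j n) := by
  have htrans : ∀ n m, n ≤ m → ∃ e : Y n ↪ₑ[K] Y m, ∀ x, j m (e x) = j n x := by
    intro n m hnm
    induction m, hnm using Nat.le_induction with
    | base => exact ⟨ElementaryEmbedding.refl K (Y n), fun x => rfl⟩
    | succ m _ ih =>
      obtain ⟨e, he⟩ := ih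
      exact ⟨(g m).comp e, fun x => (hj m _).trans (he x)⟩
  have htuple : ∀ {k : ℕ} (x : Fin k → M), ∃ n, ∃ y : Fin k → Y n, j n ∘ y = x :=
    exists_tuple_of_limit hj hs
  have hcommon : ∀ {k : ℕ} {n m : ℕ} (y : Fin k → Y n) (z : Fin k → Y m), j n ∘ y = j m ∘ z →
      ∃ (l : ℕ) (e : Y n ↪ₑ[K] Y l) (e' : Y m ↪ₑ[K] Y l), (∀ x, j l (e x) = j n x) ∧
        (∀ x, j l (e' x) = j m x) ∧ e ∘ y = e' ∘ z := by
    intro k n m y z h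
    obtain ⟨e, he⟩ := htrans n (max n m) (le_max_left _ _)
    obtain ⟨e', he'⟩ := htrans m (max n m) (le_max_right _ _)
    refine ⟨_, e, e', he, he', funext fun i => hinj _ ?_⟩
    exact (he _).trans ((congrFun h i).trans (he' _).symm)
  choose N rep hrep using fun (k : ℕ) (x : Fin k → M) => htuple x
  let S : K.Structure M :=
    { funMap := fun {k} F x => j (N k x) (funMap F (rep k x))
      RelMap := fun {k} R x => RelMap R (rep k x) }
  let emb : ∀ n, Y n ↪[K] M := fun n =>
    { toFun := j n
      inj' := hinj n
      map_fun' := fun {k} F y => by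
        obtain ⟨l, e, e', he, he', h⟩ := hcommon _ _ (hrep k (j n ∘ y))
        change j n (funMap F y) = j _ (funMap F (rep k (j n ∘ y)))
        rw [← he, ← he', e.map_fun, e'.map_fun, h]
      map_rel' := fun {k} R y => by
        obtain ⟨l, e, e', he, he', h⟩ := hcommon _ _ (hrep k (j n ∘ y))
        change RelMap R (rep k (j n ∘ y)) ↔ RelMap R y
        rw [← e.map_rel, ← e'.map_rel, h] }
  have key : ∀ {α : Type} {k : ℕ} (χ : K.BoundedFormula α k) (n : ℕ) (x : α → Y n)
      (xs : Fin k → Y n), χ.Realize (emb n ∘ x) (emb n ∘ xs) ↔ χ.Realize x xs := by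
    intro α k χ
    induction χ with
    | falsum => exact fun _ _ _ => Iff.rfl
    | equal t₁ t₂ =>
      intro n x xs
      simp only [BoundedFormula.Realize, ← Sum.comp_elim, HomClass.realize_term]
      exact (emb n).injective.eq_iff
    | rel R ts =>
      intro n x xs
      simp only [BoundedFormula.Realize, ← Sum.comp_elim, HomClass.realize_term]
      exact (emb n).map_rel R _
    | imp _ _ ih₁ ih₂ =>
      intro n x xs
      simp only [BoundedFormula.Realize, ih₁, ih₂]
    | all χ ih =>
      intro n x xs
      constructor
      · intro h y
        rw [← ih, Fin.comp_snoc]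
        exact h _
      · intro h z
        obtain ⟨m, y, rfl⟩ := hs z
        obtain ⟨e, he⟩ := htrans n (max n m) (le_max_left _ _)
        obtain ⟨e', he'⟩ := htrans m (max n m) (le_max_right _ _)
        have h' := (e.map_boundedFormula χ.all x xs).2 h (e' y)
        rw [← ih, Fin.comp_snoc] at h'
        have h₁ : emb (max n m) ∘ e ∘ x = emb n ∘ x := funext fun i => he _
        have h₂ : emb (max n m) ∘ e ∘ xs = emb n ∘ xs := funext fun i => he _
        have h₃ : emb (max n m) (e' y) = j m y := he' y
        rwa [h₁, h₂, h₃] at h'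
  refine ⟨S, fun n => ⟨⟨j n, fun k χ x => ?_⟩, fun x => rfl⟩⟩
  have := key χ n x default
  rwa [Subsingleton.elim (emb n ∘ default) default] at this

end Chain

section Amalgamation

variable {L L' : Language.{u, v}}

/-- An `L`-elementary map between two `L'`-structures. -/
structure ElementaryLink (φ : L →ᴸ L') where
  dom : Type (max u v)
  cod : Type (max u v)
  [structDom : L'.Structure dom]
  [structCod : L'.Structure cod]
  [nonemptyDom : Nonempty dom]
  map : dom → cod
  sameType : SameType φ id map

attribute [instance] ElementaryLink.structDom ElementaryLink.structCod ElementaryLink.nonemptyDom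

variable {φ : L →ᴸ L'}

theorem ElementaryLink.exists_next (l : ElementaryLink φ) :
    ∃ (C : Type (max u v)) (_ : L'.Structure C) (g : l.dom ↪ₑ[L'] C) (k : l.cod → C),
      SameType φ id k ∧ ∀ x, k (l.map x) = g x :=
  l.sameType.symm.exists_extension

/-- The second map of a zigzag whose first map is `l`. -/
noncomputable def ElementaryLink.next (l : ElementaryLink φ) : ElementaryLink φ :=
  letI := l.exists_next.choose_spec.choose
  haveI : Nonempty l.cod := l.nonemptyDom.map l.map
  { dom := l.cod
    cod := l.exists_next.choose
    map := l.exists_next.choose_spec.choose_spec.choose_spec.choose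
    sameType := l.exists_next.choose_spec.choose_spec.choose_spec.choose_spec.1 }

/-- The zigzag of `L`-elementary maps starting with `l`. -/
noncomputable def ElementaryLink.chain (l : ElementaryLink φ) : ℕ → ElementaryLink φ
  | 0 => l
  | n + 1 => (l.chain n).next

theorem ElementaryLink.exists_chain (l : ElementaryLink φ) (n : ℕ) :
    ∃ g : (l.chain n).dom ↪ₑ[L'] (l.chain (n + 2)).dom,
      ∀ x, (l.chain (n + 1)).map ((l.chain n).map x) = g x :=
  ⟨_, (l.chain n).exists_next.choose_spec.choose_spec.choose_spec.choose_spec.2⟩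

theorem SameType.injective {A B : Type*} [L'.Structure A] [L'.Structure B] {f : A → B}
    (h : SameType φ id f) : Function.Injective f :=
  fun _ _ hxy => h.symm.eq_of_eq hxy

/-- The two ends of an `L`-elementary map extend elementarily to two structures
with the same `L`-reduct. -/
theorem ElementaryLink.exists_common_reduct (l : ElementaryLink φ) :
    ∃ (M : Type (max u v)) (SA SB : L'.Structure M),
      @LHom.reduct L L' φ M SA = @LHom.reduct L L' φ M SB ∧
      ∃ (f : l.dom → M) (g : l.cod → M), @IsElementary L' l.dom M _ SA f ∧
        @IsElementary L' l.cod M _ SB g ∧ ∀ x, g (l.map x) = f x := by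
  let X : ℕ → Type (max u v) := fun n => (l.chain n).dom
  let f : ∀ n, X n → X (n + 1) := fun n => (l.chain n).map
  have hf : ∀ n, SameType φ id (f n) := fun n => (l.chain n).sameType
  obtain ⟨M, j, hinj, hj, hs⟩ := exists_sequential_limit X f fun n => (hf n).injective
  choose g hg using l.exists_chain
  have hjg : ∀ n x, j (n + 2) (g n x) = j n x := fun n x => by
    rw [← hg]
    exact (hj (n + 1) _).trans (hj n x)
  have hsA : ∀ z, ∃ n x, j (2 * n) x = z := by
    intro z
    obtain ⟨n, x, rfl⟩ := hs z
    obtain ⟨m, rfl | rfl⟩ := n.even_or_odd'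
    · exact ⟨m, x, rfl⟩
    · exact ⟨m + 1, f _ x, hj _ x⟩
  have hsB : ∀ z, ∃ n x, j (2 * n + 1) x = z := by
    intro z
    obtain ⟨n, x, rfl⟩ := hsA z
    exact ⟨n, f _ x, hj _ x⟩
  obtain ⟨SA, hA⟩ := exists_structure_of_elementary_chain (Y := fun n => X (2 * n))
    (j := fun n => j (2 * n)) (fun n => g (2 * n)) (fun n => hinj _) (fun n => hjg _) hsA
  obtain ⟨SB, hB⟩ := exists_structure_of_elementary_chain (Y := fun n => X (2 * n + 1))
    (j := fun n => j (2 * n + 1)) (fun n => g (2 * n + 1)) (fun n => hinj _) (fun n => hjg _) hsB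
  have hsame : ∀ {k : ℕ} (χ : L.Formula (Fin k)) (x : Fin k → M),
      @Formula.Realize L M (@LHom.reduct L L' φ M SA) _ χ x ↔
        @Formula.Realize L M (@LHom.reduct L L' φ M SB) _ χ x := by
    intro k χ x
    obtain ⟨n, y, rfl⟩ := exists_tuple_of_limit (Y := fun n => X (2 * n))
      (j := fun n => j (2 * n)) (f := fun n => g (2 * n)) (fun n => hjg _) hsA x
    have h₁ := (hA n).realize_iff (φ.onFormula χ) y
    have h₂ := (hB n).realize_iff (φ.onFormula χ) (f (2 * n) ∘ y)
    have h₃ : j (2 * n + 1) ∘ f (2 * n) ∘ y = j (2 * n) ∘ y := funext fun i => hj _ _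
    rw [h₃] at h₂
    rw [← @realize_onFormula_reduct _ _ φ _ _ SA, ← @realize_onFormula_reduct _ _ φ _ _ SB]
    refine h₁.trans (Iff.trans ?_ h₂.symm)
    exact (hf (2 * n)).comp y χ
  refine ⟨M, SA, SB, ?_, ?_⟩
  · ext k F x
    · have := (hsame (Formula.graph F) (Fin.cons (@funMap _ _ (@LHom.reduct L L' φ M SA) _ F x) x))
      rw [@Formula.realize_graph _ _ (_), @Formula.realize_graph _ _ (_)] at this
      exact (this.1 rfl).symm
    · exact hsame (F.formula Term.var) x
  · exact ⟨j 0, j 1, hA 0, hB 0, hj 0⟩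

/-- Robinson amalgamation: structures containing tuples of the same `L`-type extend elementarily
to two structures with the same `L`-reduct, with the tuples identified. -/
theorem SameType.exists_common_reduct {ι : Type*} {A B : Type (max u v)} [L'.Structure A]
    [L'.Structure B] [Nonempty A] [Nonempty B] {a : ι → A} {b : ι → B} (h : SameType φ a b) :
    ∃ (M : Type (max u v)) (SA SB : L'.Structure M),
      @LHom.reduct L L' φ M SA = @LHom.reduct L L' φ M SB ∧
      ∃ (f : A → M) (g : B → M), @IsElementary L' A M _ SA f ∧
        @IsElementary L' B M _ SB g ∧ ∀ i, g (b i) = f (a i) := by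
  obtain ⟨C, _, g, k, hk, hki⟩ := h.exists_extension
  obtain ⟨M, SA, SB, hred, f₁, f₂, h₁, h₂, he⟩ :=
    ElementaryLink.exists_common_reduct (⟨A, C, k, hk⟩ : ElementaryLink φ)
  refine ⟨M, SA, SB, hred, f₁, f₂ ∘ g, h₁, h₂.comp_embedding g, fun i => ?_⟩
  exact (congrArg f₂ (hki i).symm).trans (he (a i))

end Amalgamation

section Definability

variable {L L' : Language.{u, v}}

/-- A formula that is not definable over `L` modulo `Γ` separates two tuples
of the same `L`-type. -/
theorem exists_sameType_of_not_definable (φ : L →ᴸ L') (Γ : L'.Theory) {β : Type}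
    (ψ : L'.Formula β)
    (h : ¬ ∃ χ : L.Formula β, ∀ (M : Theory.ModelType.{u, v, max u v} Γ) (a : β → M),
      ψ.Realize a ↔ (φ.onFormula χ).Realize a) :
    ∃ (A B : Theory.ModelType.{u, v, max u v} Γ) (a : β → A) (b : β → B),
      SameType φ a b ∧ ψ.Realize a ∧ ¬ ψ.Realize b := by
  obtain ⟨B, b, hψb, hb⟩ := exists_realize_of_finite Γ ψ.not
    (fun χ : {χ : L.Formula β // ∀ (M : Theory.ModelType.{u, v, max u v} Γ) (a : β → M),
      ψ.Realize a → (φ.onFormula χ).Realize a} => φ.onFormula χ.1) fun F => by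
    by_contra! hF
    refine h ⟨Formula.iInf fun χ : F => χ.1.1, fun M a => ⟨fun ha => ?_, fun ha => ?_⟩⟩
    · exact (realize_onFormula_iInf φ _ _).2 fun χ => χ.1.2 M a ha
    · by_contra hn
      obtain ⟨χ, hχ, hχa⟩ := hF M a (Formula.realize_not.2 hn)
      exact hχa ((realize_onFormula_iInf φ _ _).1 ha ⟨χ, hχ⟩)
  obtain ⟨A, a, hψa, ha⟩ := exists_realize_of_finite Γ ψ
    (fun χ : {χ : L.Formula β // (φ.onFormula χ).Realize b} => φ.onFormula χ.1) fun F => by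
    by_contra! hF
    let θ : L.Formula β := Formula.iInf fun χ : F => χ.1.1
    have hθ : (φ.onFormula θ).Realize b := (realize_onFormula_iInf φ _ _).2 fun χ => χ.1.2
    refine (realize_onFormula_not φ θ b).1 (hb ⟨θ.not, fun M a ha => ?_⟩) hθ
    rw [realize_onFormula_not]
    intro hθa
    obtain ⟨χ, hχ, hχa⟩ := hF M a ha
    exact hχa ((realize_onFormula_iInf φ _ _).1 hθa ⟨χ, hχ⟩)
  refine ⟨A, B, a, b, SameType.symm (sameType_of_imp fun χ hχ => ha ⟨χ, hχ⟩), hψa, ?_⟩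
  exact Formula.realize_not.1 hψb

/-- Every formula comes from one in finitely many variables. -/
theorem exists_realize_comp_fin {α : Type w} (ψ : L'.Formula α) :
    ∃ (n : ℕ) (ι : Fin n → α) (ψ' : L'.Formula (Fin n)), Function.Injective ι ∧
      ∀ (M : Type (max u v)) (_ : L'.Structure M) (a : α → M),
        ψ.Realize a ↔ ψ'.Realize (a ∘ ι) := by
  classical
  let e := ψ.freeVarFinset.equivFin
  refine ⟨_, fun i => (e.symm i : α), BoundedFormula.restrictFreeVar ψ e,
    Subtype.val_injective.comp e.symm.injective, fun M _ a => ?_⟩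
  refine (BoundedFormula.realize_restrictFreeVar a fun x => ?_).symm
  simp

end Definability

end FirstOrder.Language

/-- **Theorem (characterization of non-definability, Hodges 6.6.4).**
Vocabularies `σ ⊆ σ'` are modelled as `σ' = L.sum L₂` (the language `L` together with fresh
symbols `L₂`), with the inclusion given by `LHom.sumInl : L →ᴸ L.sum L₂`, so that the reduct of
a `σ'`-structure to `σ` is `LHom.sumInl.reduct`.  Let `Γ` be a set of `σ'`-sentences with at
least one (nonempty) model, and let `ψ` be a `σ'`-formula with free variables indexed by `α`.
Then: there exist two models `𝒜, ℬ` of `Γ` with equal `σ`-reducts and a tuple `a` with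
`𝒜 ⊨ ψ(a) ↔ ¬ ℬ ⊨ ψ(a)`, if and only if there is no `σ`-formula `φ` equivalent to `ψ`
on all models of `Γ`. -/
theorem non_definability_iff_padoa
    {L L₂ : FirstOrder.Language.{u, v}} (Γ : (L.sum L₂).Theory) {α : Type w}
    (ψ : (L.sum L₂).Formula α)
    (hsat : ∃ (M : Type (max u v)) (S : (L.sum L₂).Structure M),
      Nonempty M ∧ @Theory.Model _ M S Γ) :
    (∃ (M : Type (max u v)) (SA SB : (L.sum L₂).Structure M), Nonempty M ∧
        @Theory.Model _ M SA Γ ∧ @Theory.Model _ M SB Γ ∧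
        @LHom.reduct L (L.sum L₂) LHom.sumInl M SA =
          @LHom.reduct L (L.sum L₂) LHom.sumInl M SB ∧
        ∃ a : α → M,
          (@Formula.Realize _ M SA α ψ a ↔ ¬ @Formula.Realize _ M SB α ψ a)) ↔
      ¬ ∃ φ : L.Formula α,
        ∀ (M : Type (max u v)) (S : (L.sum L₂).Structure M), Nonempty M →
          @Theory.Model _ M S Γ →
          ∀ a : α → M,
            @Formula.Realize _ M S α ψ a ↔
              @Formula.Realize L M (@LHom.reduct L (L.sum L₂) LHom.sumInl M S) α φ a := by
  constructor
  · rintro ⟨M, SA, SB, hne, hA, hB, hred, a, ha⟩ ⟨χ, hχ⟩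
    have h₁ := hχ M SA hne hA a
    have h₂ := hχ M SB hne hB a
    rw [hred] at h₁
    tauto
  · intro h
    obtain ⟨n, ι, ψ', hι, hψ'⟩ := exists_realize_comp_fin ψ
    obtain ⟨A, B, a, b, hab, ha, hb⟩ := exists_sameType_of_not_definable
      (LHom.sumInl : L →ᴸ L.sum L₂) Γ ψ' fun ⟨χ, hχ⟩ => h ⟨χ.relabel ι, fun M S hne hM c => by
        let := S
        rw [hψ' M S c, @Formula.realize_relabel _ _ (_), ← realize_onFormula_reduct]
        exact hχ (Theory.ModelType.of Γ M) (c ∘ ι)⟩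
    obtain ⟨M, SA, SB, hred, f, g, hf, hg, hfg⟩ := hab.exists_common_reduct
    have hne : Nonempty M := A.nonempty'.map f
    obtain ⟨c, hc⟩ : ∃ c : α → M, c ∘ ι = f ∘ a :=
      ⟨Function.extend ι (f ∘ a) fun _ => hne.some, funext fun i => hι.extend_apply _ _ i⟩
    have hc' : c ∘ ι = g ∘ b := hc.trans (funext fun i => (hfg i).symm)
    refine ⟨M, SA, SB, hne, hf.model A.is_model, hg.model B.is_model, hred, c, ?_⟩
    rw [hψ' M SA, hψ' M SB]
    refine iff_of_true ?_ ?_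
    · rw [hc]
      exact (hf.realize_iff ψ' a).2 ha
    · rw [hc', hg.realize_iff]
      exact hb
end

section
/- Let ψ be a first-order formula and Γ a finite set of first-order formulas over a vocabulary σ (formulas may use equality). Then the following are equivalent: (i) there exists a first-order formula φ over σ that does not use the equality symbol and is equivalent to ψ modulo Th(Γ); (ii) there exists a first-order formula μ over σ ∪ {E} that does not use the fresh binary relation symbol E and is equivalent to ψ* modulo Th(Γ* ∪ {δ_E}). -/
open FirstOrder Language

universe u v w

/-- The symbol set with a single binary relation symbol `E`. -/
inductive ESym : ℕ → Type
  | E : ESym 2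

/-- The language consisting of a single binary relation symbol `E` (and no other symbols). -/
def eLang : FirstOrder.Language := ⟨fun _ => Empty, ESym⟩

variable {L : FirstOrder.Language.{u, v}} {α : Type w}

/-- The star translation `ψ ↦ ψ*`: replace every equality atom `t₁ = t₂` by the atom
`E(t₁, t₂)`, yielding a formula over the extended language `L.sum eLang`. -/
def star : ∀ {n : ℕ}, L.BoundedFormula α n → (L.sum eLang).BoundedFormula α n
  | _, .falsum => .falsum
  | _, .equal t₁ t₂ =>
      .rel (Sum.inr ESym.E) ![LHom.sumInl.onTerm t₁, LHom.sumInl.onTerm t₂]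
  | _, .rel R ts => .rel (Sum.inl R) fun i => LHom.sumInl.onTerm (ts i)
  | _, .imp f g => (star f).imp (star g)
  | _, .all f => (star f).all

/-- A first-order formula does not use the equality symbol. -/
def EqualityFree : ∀ {n : ℕ}, L.BoundedFormula α n → Prop
  | _, .falsum => True
  | _, .equal _ _ => False
  | _, .rel _ _ => True
  | _, .imp f g => EqualityFree f ∧ EqualityFree g
  | _, .all f => EqualityFree f

/-- A formula over `L.sum eLang` does not use the relation symbol `E`. -/
def EFree : ∀ {n : ℕ}, (L.sum eLang).BoundedFormula α n → Prop
  | _, .falsum => True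
  | _, .equal _ _ => True
  | _, .rel R _ => ∃ R₀, R = Sum.inl R₀
  | _, .imp f g => EFree f ∧ EFree g
  | _, .all f => EFree f

/-- The `eLang`-structure on `M` interpreting `E` as a given binary relation. -/
def eStructure (M : Type*) (E : M → M → Prop) : eLang.Structure M where
  funMap := fun f _ => f.elim
  RelMap := fun r x => match r with | ESym.E => E (x 0) (x 1)

/-- The interpretation of the symbol `E` in a structure for `L.sum eLang`. -/
def interpE {M : Type*} (S' : (L.sum eLang).Structure M) : M → M → Prop :=
  fun a b => @Structure.RelMap (L.sum eLang) M S' 2 (Sum.inr ESym.E) ![a, b]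

/-- `E` is a congruence on the `L`-structure `S`: an equivalence relation compatible with
all function and relation symbols of `L`. -/
def IsCongruence (L : FirstOrder.Language.{u, v}) {M : Type*} (S : L.Structure M)
    (E : M → M → Prop) : Prop :=
  Equivalence E ∧
    (∀ (n : ℕ) (f : L.Functions n) (x y : Fin n → M), (∀ i, E (x i) (y i)) →
      E (@Structure.funMap L M S n f x) (@Structure.funMap L M S n f y)) ∧
    (∀ (n : ℕ) (r : L.Relations n) (x y : Fin n → M), (∀ i, E (x i) (y i)) →
      (@Structure.RelMap L M S n r x ↔ @Structure.RelMap L M S n r y))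

/-- The quotient structure of an `L`-structure by (the setoid of) a congruence. -/
noncomputable def quotientStructureOf {M : Type*} (S : L.Structure M) (s : Setoid M) :
    L.Structure (Quotient s) where
  funMap := fun {n} f x => Quotient.mk s (@Structure.funMap L M S n f fun i => (x i).out)
  RelMap := fun {n} r x => @Structure.RelMap L M S n r fun i => (x i).out

namespace ElimEq

open FirstOrder.Language.Structure

section Star

variable {M N : Type*}

/-- A surjection `π` from an `L.sum eLang`-structure onto an `L`-structure that commutes with the
functions, preserves and reflects the relations of `L`, and has the relation `E` as its kernel. -/
structure IsStrictQuotient [S' : (L.sum eLang).Structure M] [L.Structure N] (π : M → N) :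
    Prop where
  surjective : Function.Surjective π
  map_fun : ∀ {n : ℕ} (f : L.Functions n) (x : Fin n → M),
    π (funMap (L := L.sum eLang) (Sum.inl f) x) = funMap f (π ∘ x)
  map_rel : ∀ {n : ℕ} (r : L.Relations n) (x : Fin n → M),
    RelMap (L := L.sum eLang) (Sum.inl r) x ↔ RelMap r (π ∘ x)
  interpE_iff : ∀ x y : M, interpE S' x y ↔ π x = π y

variable [S' : (L.sum eLang).Structure M] [L.Structure N] {π : M → N}

theorem IsStrictQuotient.realize_onTerm (hπ : IsStrictQuotient (L := L) π) {β : Type*}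
    (t : L.Term β) (v : β → M) :
    π ((LHom.sumInl.onTerm t : (L.sum eLang).Term β).realize v) = t.realize (π ∘ v) := by
  induction t with
  | var => rfl
  | func f ts ih =>
    refine (hπ.map_fun f _).trans ?_
    exact congrArg (funMap f) (funext ih)

theorem IsStrictQuotient.realize_star (hπ : IsStrictQuotient (L := L) π) {n : ℕ}
    (φ : L.BoundedFormula α n) (v : α → M) (xs : Fin n → M) :
    (star φ).Realize v xs ↔ φ.Realize (π ∘ v) (π ∘ xs) := by
  induction φ with
  | falsum => rfl
  | equal t₁ t₂ =>
    have key := hπ.interpE_iff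
      ((LHom.sumInl.onTerm t₁ : (L.sum eLang).Term _).realize (Sum.elim v xs))
      ((LHom.sumInl.onTerm t₂ : (L.sum eLang).Term _).realize (Sum.elim v xs))
    rw [hπ.realize_onTerm, hπ.realize_onTerm, Sum.comp_elim] at key
    refine Iff.trans ?_ key
    refine iff_of_eq (congrArg (RelMap (L := L.sum eLang) (Sum.inr ESym.E)) (funext fun i => ?_))
    fin_cases i <;> rfl
  | rel R ts =>
    refine (hπ.map_rel R _).trans (iff_of_eq (congrArg (RelMap R) (funext fun i => ?_)))
    exact (hπ.realize_onTerm _ _).trans (by rw [Sum.comp_elim])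
  | imp f g ihf ihg => exact imp_congr (ihf xs) (ihg xs)
  | all f ih =>
    simp only [_root_.star, BoundedFormula.Realize]
    rw [hπ.surjective.forall]
    refine forall_congr' fun a => ?_
    rw [ih, Fin.comp_snoc]

theorem IsStrictQuotient.isCongruence (hπ : IsStrictQuotient (L := L) π) :
    IsCongruence L (@LHom.reduct L (L.sum eLang) LHom.sumInl M S') (interpE S') := by
  have comp_eq : ∀ {n : ℕ} {x y : Fin n → M}, (∀ i, interpE S' (x i) (y i)) → π ∘ x = π ∘ y :=
    fun h => funext fun i => (hπ.interpE_iff _ _).1 (h i)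
  refine ⟨⟨fun x => ?_, fun {x y} h => ?_, fun {x y z} h h' => ?_⟩, fun n f x y h => ?_,
    fun n r x y h => ?_⟩
  · simp only [hπ.interpE_iff]
  · simp only [hπ.interpE_iff] at *
    exact h.symm
  · simp only [hπ.interpE_iff] at *
    exact h.trans h'
  · refine (hπ.interpE_iff _ _).2 ?_
    exact (hπ.map_fun f x).trans ((congrArg _ (comp_eq h)).trans (hπ.map_fun f y).symm)
  · exact (hπ.map_rel r x).trans ((iff_of_eq (congrArg _ (comp_eq h))).trans (hπ.map_rel r y).symm)

end Star

theorem eFree_star {n : ℕ} {φ : L.BoundedFormula α n} (h : EqualityFree φ) : EFree (star φ) := by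
  induction φ with
  | falsum => trivial
  | equal => exact h.elim
  | rel R ts => exact ⟨R, rfl⟩
  | imp f g ihf ihg => exact ⟨ihf h.1, ihg h.2⟩
  | all f ih => exact ih h

theorem quotient_isStrictQuotient {M : Type*} (S' : (L.sum eLang).Structure M)
    (h : IsCongruence L (@LHom.reduct L (L.sum eLang) LHom.sumInl M S') (interpE S')) :
    letI := quotientStructureOf (@LHom.reduct L (L.sum eLang) LHom.sumInl M S') ⟨_, h.1⟩
    IsStrictQuotient (L := L) (Quotient.mk (⟨_, h.1⟩ : Setoid M)) := by
  let := quotientStructureOf (@LHom.reduct L (L.sum eLang) LHom.sumInl M S') ⟨_, h.1⟩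
  have out_rel : ∀ {n : ℕ} (x : Fin n → M) (i : Fin n),
      interpE S' (x i) (Quotient.mk (⟨_, h.1⟩ : Setoid M) (x i)).out :=
    fun x i => h.1.symm (Quotient.mk_out (s := ⟨_, h.1⟩) (x i))
  exact
    { surjective := Quotient.mk_surjective
      map_fun := fun f x => Quotient.sound (h.2.1 _ f _ _ (out_rel x))
      map_rel := fun r x => h.2.2 _ r _ _ (out_rel x)
      interpE_iff := fun x y => Quotient.eq (r := ⟨_, h.1⟩).symm }

section TermModel

variable {V : Type*} {A : Type*} [L.Structure A]

/-- The term algebra over `V`, with relations pulled back along the evaluation of terms in `A` and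
with `E` interpreted as the kernel of the evaluation. -/
@[reducible]
def termStructure (ev : V → A) : (L.sum eLang).Structure (L.Term V) where
  funMap := fun f ts => match f with
    | Sum.inl f => Term.func f ts
    | Sum.inr f => f.elim
  RelMap := fun r ts => match r with
    | Sum.inl r => RelMap r fun i => (ts i).realize ev
    | Sum.inr ESym.E => (ts 0).realize ev = (ts 1).realize ev

theorem termStructure_isStrictQuotient {ev : V → A} (hev : Function.Surjective ev) :
    letI := termStructure (L := L) ev
    IsStrictQuotient (L := L) (fun t : L.Term V => t.realize ev) :=
  letI := termStructure (L := L) ev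
  { surjective := fun a => (hev a).elim fun x hx => ⟨Term.var x, hx⟩
    map_fun := fun _ _ => rfl
    map_rel := fun _ _ => Iff.rfl
    interpE_iff := fun _ _ => Iff.rfl }

theorem relabel_injective {V W : Type*} {g : V → W} (hg : Function.Injective g) :
    Function.Injective (Term.relabel g : L.Term V → L.Term W) := by
  intro s
  induction s with
  | var x =>
    intro t h
    cases t with
    | var y => exact congrArg _ (hg (Term.var.inj h))
    | func => cases h
  | func f ts ih =>
    intro t h
    cases t with
    | var y => cases h
    | func f' ts' =>
      simp only [Term.relabel, Term.func.injEq] at h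
      obtain ⟨rfl, h, h'⟩ := h
      cases h
      exact congrArg _ (funext fun i => ih i (congrFun (eq_of_heq h') i))

theorem exists_relabel_eq {V W : Type*} [DecidableEq W] {g : V → W} (t : L.Term W)
    (h : ∀ q ∈ t.varFinset, q ∈ Set.range g) : ∃ s : L.Term V, s.relabel g = t := by
  induction t with
  | var x =>
    obtain ⟨y, rfl⟩ := h x (by simp [Term.varFinset])
    exact ⟨Term.var y, rfl⟩
  | func f ts ih =>
    choose s hs using fun i => ih i fun q hq =>
      h q (Finset.mem_biUnion.2 ⟨i, Finset.mem_univ i, hq⟩)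
    exact ⟨Term.func f s, congrArg _ (funext hs)⟩

end TermModel

section BackForth

variable {P A B : Type*}

/-- A back-and-forth system between `A` and `B`, with parameters `va` and `vb`, whose tuples agree
on the relational atomic formulas. -/
structure BackForth (L : FirstOrder.Language.{u, v}) {P A B : Type*} [L.Structure A]
    [L.Structure B] (va : P → A) (vb : P → B) (I : ∀ n, (Fin n → A) → (Fin n → B) → Prop) :
    Prop where
  forth : ∀ {n a b}, I n a b → ∀ c, ∃ d, I (n + 1) (Fin.snoc a c) (Fin.snoc b d)
  back : ∀ {n a b}, I n a b → ∀ d, ∃ c, I (n + 1) (Fin.snoc a c) (Fin.snoc b d)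
  rel : ∀ {n a b}, I n a b → ∀ {k} (r : L.Relations k) (ts : Fin k → L.Term (P ⊕ Fin n)),
    RelMap r (fun i => (ts i).realize (Sum.elim va a)) ↔
      RelMap r (fun i => (ts i).realize (Sum.elim vb b))

variable {I : ∀ n, (Fin n → A) → (Fin n → B) → Prop}

/-- Distinct variables `x i` over `A` are matched with distinct variables `y i` over `B`, so that
the underlying elements belong to the back-and-forth system. -/
structure IsPosition (I : ∀ n, (Fin n → A) → (Fin n → B) → Prop) {n : ℕ} (x : Fin n → A × ℕ)
    (y : Fin n → B × ℕ) : Prop where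
  left_injective : Function.Injective x
  right_injective : Function.Injective y
  mem : I n (Prod.fst ∘ x) (Prod.fst ∘ y)

theorem IsPosition.symm {n : ℕ} {x : Fin n → A × ℕ} {y : Fin n → B × ℕ} (h : IsPosition I x y) :
    IsPosition (fun n b a => I n a b) y x :=
  ⟨h.right_injective, h.left_injective, h.mem⟩

/-- The terms `t` and `t'` arise from the same term by substituting the variables `x` and `y`. -/
def Matched {X Y : Type*} {n : ℕ} (x : Fin n → X) (y : Fin n → Y) (t : L.Term (P ⊕ X))
    (t' : L.Term (P ⊕ Y)) : Prop :=
  ∃ s : L.Term (P ⊕ Fin n), s.relabel (Sum.map id x) = t ∧ s.relabel (Sum.map id y) = t'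

theorem Matched.symm {X Y : Type*} {n : ℕ} {x : Fin n → X} {y : Fin n → Y} {t : L.Term (P ⊕ X)}
    {t' : L.Term (P ⊕ Y)} (h : Matched x y t t') : Matched y x t' t :=
  let ⟨s, hs, hs'⟩ := h
  ⟨s, hs', hs⟩

theorem Matched.of_comp {X Y : Type*} {n n' : ℕ} {x : Fin n' → X} {y : Fin n' → Y}
    (e : Fin n → Fin n') {t : L.Term (P ⊕ X)} {t' : L.Term (P ⊕ Y)}
    (h : Matched (x ∘ e) (y ∘ e) t t') : Matched x y t t' := by
  obtain ⟨s, rfl, rfl⟩ := h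
  exact ⟨s.relabel (Sum.map id e), by simp [Term.relabel_relabel, Sum.map_comp_map],
    by simp [Term.relabel_relabel, Sum.map_comp_map]⟩

theorem Matched.eq_iff {n : ℕ} {x : Fin n → A × ℕ} {y : Fin n → B × ℕ} (hxy : IsPosition I x y)
    {t₁ t₂ : L.Term (P ⊕ A × ℕ)} {t₁' t₂' : L.Term (P ⊕ B × ℕ)} (h₁ : Matched x y t₁ t₁')
    (h₂ : Matched x y t₂ t₂') : t₁ = t₂ ↔ t₁' = t₂' := by
  obtain ⟨s₁, rfl, rfl⟩ := h₁
  obtain ⟨s₂, rfl, rfl⟩ := h₂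
  rw [(relabel_injective (Sum.map_injective.2
      ⟨Function.injective_id, hxy.left_injective⟩)).eq_iff,
    (relabel_injective (Sum.map_injective.2
      ⟨Function.injective_id, hxy.right_injective⟩)).eq_iff]

variable [L.Structure A] [L.Structure B] {va : P → A} {vb : P → B}

theorem BackForth.symm (h : BackForth L va vb I) : BackForth L vb va fun n b a => I n a b where
  forth := h.back
  back := h.forth
  rel := fun hI _ r ts => (h.rel hI r ts).symm

theorem BackForth.extend_variable (h : BackForth L va vb I) {n : ℕ} {x : Fin n → A × ℕ}
    {y : Fin n → B × ℕ} (hxy : IsPosition I x y) (q : A × ℕ) :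
    ∃ (n' : ℕ) (x' : Fin n' → A × ℕ) (y' : Fin n' → B × ℕ) (e : Fin n → Fin n'),
      IsPosition I x' y' ∧ x' ∘ e = x ∧ y' ∘ e = y ∧ q ∈ Set.range x' := by
  by_cases hq : q ∈ Set.range x
  · exact ⟨n, x, y, id, hxy, rfl, rfl, hq⟩
  · obtain ⟨b, hb⟩ := h.forth hxy.mem q.1
    obtain ⟨j, hj⟩ := ((Set.finite_range y).preimage
      (Prod.mk_right_injective b).injOn).exists_notMem
    refine ⟨n + 1, Fin.snoc x q, Fin.snoc y (b, j), Fin.castSucc,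
      ⟨Fin.snoc_injective_of_injective hxy.left_injective hq,
        Fin.snoc_injective_of_injective hxy.right_injective hj, ?_⟩,
      funext fun i => by simp, funext fun i => by simp, Fin.last n, by simp⟩
    rwa [Fin.comp_snoc, Fin.comp_snoc]

theorem BackForth.extend_finset (h : BackForth L va vb I) {n : ℕ} {x : Fin n → A × ℕ}
    {y : Fin n → B × ℕ} (hxy : IsPosition I x y) (T : Finset (A × ℕ)) :
    ∃ (n' : ℕ) (x' : Fin n' → A × ℕ) (y' : Fin n' → B × ℕ) (e : Fin n → Fin n'),
      IsPosition I x' y' ∧ x' ∘ e = x ∧ y' ∘ e = y ∧ ∀ q ∈ T, q ∈ Set.range x' := by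
  classical
  induction T using Finset.induction_on with
  | empty => exact ⟨n, x, y, id, hxy, rfl, rfl, by simp⟩
  | insert q T _ ih =>
    obtain ⟨n₁, x₁, y₁, e₁, h₁, rfl, rfl, hT⟩ := ih
    obtain ⟨n₂, x₂, y₂, e₂, h₂, rfl, rfl, hq⟩ := h.extend_variable h₁ q
    refine ⟨n₂, x₂, y₂, e₂ ∘ e₁, h₂, rfl, rfl, fun p hp => ?_⟩
    obtain rfl | hp := Finset.mem_insert.1 hp
    · exact hq
    · obtain ⟨i, rfl⟩ := hT p hp
      exact ⟨e₂ i, rfl⟩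

theorem BackForth.extend_term (h : BackForth L va vb I) {n : ℕ} {x : Fin n → A × ℕ}
    {y : Fin n → B × ℕ} (hxy : IsPosition I x y) (t : L.Term (P ⊕ A × ℕ)) :
    ∃ (n' : ℕ) (x' : Fin n' → A × ℕ) (y' : Fin n' → B × ℕ) (e : Fin n → Fin n'),
      IsPosition I x' y' ∧ x' ∘ e = x ∧ y' ∘ e = y ∧ ∃ t', Matched x' y' t t' := by
  classical
  obtain ⟨n', x', y', e, h', hx, hy, hT⟩ :=
    h.extend_finset hxy (t.varFinset.preimage Sum.inr Sum.inr_injective.injOn)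
  obtain ⟨s, hs⟩ := exists_relabel_eq (g := Sum.map id x') t fun q hq => by
    cases q with
    | inl p => exact ⟨Sum.inl p, rfl⟩
    | inr q =>
      obtain ⟨i, rfl⟩ := hT q (by simpa using hq)
      exact ⟨Sum.inr i, rfl⟩
  exact ⟨n', x', y', e, h', hx, hy, _, s, hs, rfl⟩

/-- Evaluation of the variables of the term models. -/
def evalVar (va : P → A) : P ⊕ A × ℕ → A := Sum.elim va Prod.fst

theorem realize_relabel_evalVar {n : ℕ} (x : Fin n → A × ℕ) (s : L.Term (P ⊕ Fin n)) :
    (s.relabel (Sum.map id x)).realize (evalVar va) =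
      s.realize (Sum.elim va (Prod.fst ∘ x)) := by
  rw [Term.realize_relabel, evalVar, Sum.elim_comp_map, Function.comp_id]

theorem Matched.realize {n : ℕ} {x : Fin n → A × ℕ} {y : Fin n → B × ℕ} {β : Type*}
    (t : (L.sum eLang).Term β) {v : β → L.Term (P ⊕ A × ℕ)} {v' : β → L.Term (P ⊕ B × ℕ)}
    (h : ∀ b, Matched x y (v b) (v' b)) :
    Matched x y (@Term.realize _ _ (termStructure (evalVar va)) _ v t)
      (@Term.realize _ _ (termStructure (evalVar vb)) _ v' t) := by
  induction t with
  | var b => exact h b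
  | func f ts ih =>
    cases f with
    | inl f =>
      choose s hs hs' using ih
      exact ⟨Term.func f s, congrArg (Term.func f) (funext hs),
        congrArg (Term.func f) (funext hs')⟩
    | inr f => exact f.elim

theorem BackForth.relMap_iff (h : BackForth L va vb I) {n : ℕ} {x : Fin n → A × ℕ}
    {y : Fin n → B × ℕ} (hxy : IsPosition I x y) {k : ℕ} (r : L.Relations k)
    {ts : Fin k → L.Term (P ⊕ A × ℕ)} {ts' : Fin k → L.Term (P ⊕ B × ℕ)}
    (hts : ∀ i, Matched x y (ts i) (ts' i)) :
    RelMap r (fun i => (ts i).realize (evalVar va)) ↔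
      RelMap r (fun i => (ts' i).realize (evalVar vb)) := by
  choose s hs hs' using hts
  simp only [← hs, ← hs', realize_relabel_evalVar]
  exact h.rel hxy.mem r s

/-- The term models over back-and-forth equivalent structures satisfy the same formulas without
`E`, possibly with equality. -/
theorem BackForth.realize_iff (h : BackForth L va vb I) {k : ℕ}
    {χ : (L.sum eLang).BoundedFormula α k} (hχ : EFree χ) {n : ℕ} {x : Fin n → A × ℕ}
    {y : Fin n → B × ℕ} (hxy : IsPosition I x y) {w : α → L.Term (P ⊕ A × ℕ)}
    {w' : α → L.Term (P ⊕ B × ℕ)} {z : Fin k → L.Term (P ⊕ A × ℕ)}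
    {z' : Fin k → L.Term (P ⊕ B × ℕ)} (hw : ∀ a, Matched x y (w a) (w' a))
    (hz : ∀ j, Matched x y (z j) (z' j)) :
    @BoundedFormula.Realize _ _ (termStructure (evalVar va)) _ _ χ w z ↔
      @BoundedFormula.Realize _ _ (termStructure (evalVar vb)) _ _ χ w' z' := by
  induction χ generalizing n with
  | falsum => rfl
  | equal t₁ t₂ =>
    have hwz : ∀ b, Matched x y (Sum.elim w z b) (Sum.elim w' z' b) := by
      rintro (a | j)
      exacts [hw a, hz j]
    exact Matched.eq_iff hxy (Matched.realize t₁ hwz) (Matched.realize t₂ hwz)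
  | rel R ts =>
    have hwz : ∀ b, Matched x y (Sum.elim w z b) (Sum.elim w' z' b) := by
      rintro (a | j)
      exacts [hw a, hz j]
    obtain ⟨R, rfl⟩ := hχ
    exact h.relMap_iff hxy R fun i => Matched.realize (ts i) hwz
  | imp f g ihf ihg => exact imp_congr (ihf hχ.1 hxy hw hz) (ihg hχ.2 hxy hw hz)
  | all f ih =>
    have snoc_matched : ∀ {n' : ℕ} {x' : Fin n' → A × ℕ} {y' : Fin n' → B × ℕ}
        (e : Fin n → Fin n') {t : L.Term (P ⊕ A × ℕ)} {t' : L.Term (P ⊕ B × ℕ)},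
        x' ∘ e = x → y' ∘ e = y → Matched x' y' t t' →
        ∀ j, Matched x' y' ((Fin.snoc z t : Fin _ → L.Term (P ⊕ A × ℕ)) j)
          ((Fin.snoc z' t' : Fin _ → L.Term (P ⊕ B × ℕ)) j) := by
      rintro n' x' y' e t t' rfl rfl ht j
      induction j using Fin.lastCases with
      | last => simpa using ht
      | cast j => simpa using (hz j).of_comp e
    constructor
    · intro H t'
      obtain ⟨n', y', x', e, hp, hy, hx, t, ht⟩ := h.symm.extend_term hxy.symm t'
      exact (ih hχ hp.symm (fun a => Matched.of_comp e (by rw [hx, hy]; exact hw a))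
        (snoc_matched e hx hy ht.symm)).1 (H t)
    · intro H t
      obtain ⟨n', x', y', e, hp, hx, hy, t', ht⟩ := h.extend_term hxy t
      exact (ih hχ hp (fun a => Matched.of_comp e (by rw [hx, hy]; exact hw a))
        (snoc_matched e hx hy ht)).2 (H t')

end BackForth

section EqualityFree

theorem equalityFree_iInf {n : ℕ} {β : Type*} [Finite β] {f : β → L.BoundedFormula α n}
    (h : ∀ b, EqualityFree (f b)) : EqualityFree (BoundedFormula.iInf f) := by
  have foldr : ∀ l : List β, EqualityFree ((l.map f).foldr (· ⊓ ·) ⊤) := by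
    intro l
    induction l with
    | nil => exact ⟨trivial, trivial⟩
    | cons b l ih => exact ⟨⟨h b, ih, trivial⟩, trivial⟩
  exact foldr _

theorem equalityFree_iSup {n : ℕ} {β : Type*} [Finite β] {f : β → L.BoundedFormula α n}
    (h : ∀ b, EqualityFree (f b)) : EqualityFree (BoundedFormula.iSup f) := by
  have foldr : ∀ l : List β, EqualityFree ((l.map f).foldr (· ⊔ ·) ⊥) := by
    intro l
    induction l with
    | nil => exact trivial
    | cons b l ih => exact ⟨⟨h b, trivial⟩, ih⟩
  exact foldr _

theorem equalityFree_subst {β : Type*} {n : ℕ} {φ : L.BoundedFormula α n} (f : α → L.Term β)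
    (h : EqualityFree φ) : EqualityFree (φ.subst f) := by
  induction φ with
  | falsum => trivial
  | equal => exact h.elim
  | rel => trivial
  | imp f g ihf ihg => exact ⟨ihf h.1, ihg h.2⟩
  | all f ih => exact ih h

open Classical in
/-- The conjunction asserting that exactly the formulas of `Δ` that belong to `T` hold. -/
noncomputable def typeFormula {n : ℕ} (Δ T : Finset (L.BoundedFormula α n)) :
    L.BoundedFormula α n :=
  BoundedFormula.iInf fun θ : Δ => if θ.1 ∈ T then θ.1 else θ.1.not

theorem equalityFree_typeFormula {n : ℕ} {Δ T : Finset (L.BoundedFormula α n)}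
    (h : ∀ θ ∈ Δ, EqualityFree θ) : EqualityFree (typeFormula Δ T) :=
  equalityFree_iInf fun θ => by
    split_ifs
    exacts [h _ θ.2, ⟨h _ θ.2, trivial⟩]

theorem realize_typeFormula {n : ℕ} {Δ T : Finset (L.BoundedFormula α n)} {A : Type*}
    [L.Structure A] {v : α → A} {xs : Fin n → A} :
    (typeFormula Δ T).Realize v xs ↔ ∀ θ ∈ Δ, (θ.Realize v xs ↔ θ ∈ T) := by
  rw [typeFormula, BoundedFormula.realize_iInf, Subtype.forall]
  refine forall₂_congr fun θ _ => ?_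
  split_ifs with h <;> simp [h]

open Classical in
/-- The formulas of `Δ` that hold at a given assignment. -/
noncomputable def trueFormulas {n : ℕ} (Δ : Finset (L.BoundedFormula α n)) {A : Type*}
    [L.Structure A] (v : α → A) (xs : Fin n → A) : Finset (L.BoundedFormula α n) :=
  Δ.filter fun θ => θ.Realize v xs

theorem realize_typeFormula_trueFormulas {n : ℕ} {Δ : Finset (L.BoundedFormula α n)} {A B : Type*}
    [L.Structure A] [L.Structure B] {v : α → A} {xs : Fin n → A} {v' : α → B} {xs' : Fin n → B} :
    (typeFormula Δ (trueFormulas Δ v xs)).Realize v' xs' ↔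
      ∀ θ ∈ Δ, (θ.Realize v xs ↔ θ.Realize v' xs') := by
  rw [realize_typeFormula]
  refine forall₂_congr fun θ hθ => ?_
  simp only [trueFormulas, Finset.mem_filter, and_iff_right hθ, iff_comm]

end EqualityFree

section RankEquiv

variable {P : Type*} {A B : Type*} [L.Structure A] [L.Structure B]

/-- Equivalence of tuples with respect to the equality-free formulas of `F` and `d` rounds of the
back-and-forth game. -/
def RankEquiv (F : Finset (Σ n, L.BoundedFormula P n)) (va : P → A) (vb : P → B) :
    ℕ → ∀ n, (Fin n → A) → (Fin n → B) → Prop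
  | 0, n, a, b =>
    ∀ θ : L.BoundedFormula P n, ⟨n, θ⟩ ∈ F → EqualityFree θ → (θ.Realize va a ↔ θ.Realize vb b)
  | d + 1, n, a, b =>
    RankEquiv F va vb 0 n a b ∧
      (∀ c, ∃ e, RankEquiv F va vb d (n + 1) (Fin.snoc a c) (Fin.snoc b e)) ∧
      ∀ e, ∃ c, RankEquiv F va vb d (n + 1) (Fin.snoc a c) (Fin.snoc b e)

theorem rankEquiv_zero {F : Finset (Σ n, L.BoundedFormula P n)} {va : P → A} {vb : P → B} {n : ℕ}
    {a : Fin n → A} {b : Fin n → B} : RankEquiv F va vb 0 n a b ↔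
      ∀ θ : L.BoundedFormula P n, ⟨n, θ⟩ ∈ F → EqualityFree θ →
        (θ.Realize va a ↔ θ.Realize vb b) := by
  rw [RankEquiv]

theorem rankEquiv_succ {F : Finset (Σ n, L.BoundedFormula P n)} {va : P → A} {vb : P → B}
    {d n : ℕ} {a : Fin n → A} {b : Fin n → B} : RankEquiv F va vb (d + 1) n a b ↔
      RankEquiv F va vb 0 n a b ∧
        (∀ c, ∃ e, RankEquiv F va vb d (n + 1) (Fin.snoc a c) (Fin.snoc b e)) ∧
        ∀ e, ∃ c, RankEquiv F va vb d (n + 1) (Fin.snoc a c) (Fin.snoc b e) := by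
  conv_lhs => rw [RankEquiv]

theorem RankEquiv.zero {F : Finset (Σ n, L.BoundedFormula P n)} {va : P → A} {vb : P → B}
    {d n : ℕ} {a : Fin n → A} {b : Fin n → B} (h : RankEquiv F va vb d n a b) :
    RankEquiv F va vb 0 n a b := by
  cases d with
  | zero => exact h
  | succ d => exact (rankEquiv_succ.1 h).1

universe x in
/-- Bounded-round equivalence is implied by agreement on finitely many equality-free formulas. -/
theorem exists_finset_rankEquiv (F : Finset (Σ n, L.BoundedFormula P n)) (d n : ℕ) :
    ∃ Δ : Finset (L.BoundedFormula P n), (∀ θ ∈ Δ, EqualityFree θ) ∧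
      ∀ (A B : Type x) [L.Structure A] [L.Structure B] (va : P → A) (vb : P → B) (a : Fin n → A)
        (b : Fin n → B), (∀ θ ∈ Δ, (θ.Realize va a ↔ θ.Realize vb b)) →
        RankEquiv F va vb d n a b := by
  classical
  have zero : ∀ n, ∃ Δ : Finset (L.BoundedFormula P n), (∀ θ ∈ Δ, EqualityFree θ) ∧
      ∀ (A B : Type x) [L.Structure A] [L.Structure B] (va : P → A) (vb : P → B) (a : Fin n → A)
        (b : Fin n → B), (∀ θ ∈ Δ, (θ.Realize va a ↔ θ.Realize vb b)) →
        RankEquiv F va vb 0 n a b := fun n =>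
    ⟨(F.preimage (Sigma.mk n) sigma_mk_injective.injOn).filter EqualityFree,
      fun θ hθ => (Finset.mem_filter.1 hθ).2, fun A B _ _ va vb a b h =>
        rankEquiv_zero.2 fun θ hF hθ =>
          h θ (Finset.mem_filter.2 ⟨Finset.mem_preimage.2 hF, hθ⟩)⟩
  induction d generalizing n with
  | zero => exact zero n
  | succ d ih =>
    obtain ⟨Δ₀, hΔ₀, h₀⟩ := zero n
    obtain ⟨Δ, hΔ, h⟩ := ih (n + 1)
    refine ⟨Δ₀ ∪ Δ.powerset.image fun T => (typeFormula Δ T).ex, fun θ hθ => ?_,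
      fun A B _ _ va vb a b hab => rankEquiv_succ.2
        ⟨h₀ A B va vb a b fun θ hθ => hab θ (Finset.mem_union_left _ hθ),
          fun c => ?_, fun e => ?_⟩⟩
    · obtain hθ | hθ := Finset.mem_union.1 hθ
      · exact hΔ₀ θ hθ
      · obtain ⟨T, -, rfl⟩ := Finset.mem_image.1 hθ
        exact ⟨⟨equalityFree_typeFormula hΔ, trivial⟩, trivial⟩
    · have hc := hab (typeFormula Δ (trueFormulas Δ va (Fin.snoc a c))).ex
        (Finset.mem_union_right _ (Finset.mem_image_of_mem _
          (Finset.mem_powerset.2 (Finset.filter_subset _ _))))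
      simp only [BoundedFormula.realize_ex, realize_typeFormula_trueFormulas] at hc
      obtain ⟨e, he⟩ := hc.1 ⟨c, fun _ _ => Iff.rfl⟩
      exact ⟨e, h A B va vb _ _ he⟩
    · have he := hab (typeFormula Δ (trueFormulas Δ vb (Fin.snoc b e))).ex
        (Finset.mem_union_right _ (Finset.mem_image_of_mem _
          (Finset.mem_powerset.2 (Finset.filter_subset _ _))))
      simp only [BoundedFormula.realize_ex, realize_typeFormula_trueFormulas] at he
      obtain ⟨c, hc⟩ := he.2 ⟨e, fun _ _ => Iff.rfl⟩
      exact ⟨c, h A B va vb _ _ fun θ hθ => (hc θ hθ).symm⟩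

end RankEquiv

section Ultraproduct

variable {P : Type*} {ι : Type*} (U : Ultrafilter ι) {A B : ι → Type*} [∀ i, L.Structure (A i)]
  [∀ i, L.Structure (B i)]

/-- Tuples of two ultraproducts with representatives that are almost everywhere
`RankEquiv`-equivalent, with the number of rounds decreasing in the length of the tuple. -/
def UltraRankEquiv (F : ι → Finset (Σ n, L.BoundedFormula P n)) (N : ι → ℕ)
    (va : ∀ i, P → A i) (vb : ∀ i, P → B i) (n : ℕ)
    (a : Fin n → (U : Filter ι).Product A) (b : Fin n → (U : Filter ι).Product B) : Prop :=
  ∃ (a' : Fin n → ∀ i, A i) (b' : Fin n → ∀ i, B i),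
    (fun j => (a' j : (U : Filter ι).Product A)) = a ∧
    (fun j => (b' j : (U : Filter ι).Product B)) = b ∧
    ∀ᶠ i in U, RankEquiv (F i) (va i) (vb i) (N i - n) n (fun j => a' j i) (fun j => b' j i)

theorem snoc_apply_eq {n : ℕ} (a : Fin n → ∀ i, A i) (c : ∀ i, A i) (i : ι) :
    (fun j => (Fin.snoc a c : Fin (n + 1) → ∀ i, A i) j i) = Fin.snoc (fun j => a j i) (c i) :=
  Fin.comp_snoc (fun f : ∀ i, A i => f i) a c

theorem coe_snoc {n : ℕ} (a : Fin n → ∀ i, A i) (c : ∀ i, A i) :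
    (fun j => ((Fin.snoc a c : Fin (n + 1) → ∀ i, A i) j : (U : Filter ι).Product A)) =
      Fin.snoc (fun j => (a j : (U : Filter ι).Product A)) (c : (U : Filter ι).Product A) :=
  Fin.comp_snoc (fun f : ∀ i, A i => (f : (U : Filter ι).Product A)) a c

variable [∀ i, Nonempty (A i)] [∀ i, Nonempty (B i)]

theorem ultraRankEquiv_backForth {F : ι → Finset (Σ n, L.BoundedFormula P n)} {N : ι → ℕ}
    (hF : ∀ n (θ : L.BoundedFormula P n), ∀ᶠ i in U, ⟨n, θ⟩ ∈ F i)
    (hN : ∀ n, ∀ᶠ i in U, n < N i) (va : ∀ i, P → A i) (vb : ∀ i, P → B i) :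
    BackForth L (fun p => ((fun i => va i p : ∀ i, A i) : (U : Filter ι).Product A))
      (fun p => ((fun i => vb i p : ∀ i, B i) : (U : Filter ι).Product B))
      (UltraRankEquiv U F N va vb) where
  forth := by
    rintro n _ _ ⟨a, b, rfl, rfl, h⟩ c
    obtain ⟨c, rfl⟩ := Quotient.exists_rep c
    have step : ∀ i, ∃ e, RankEquiv (F i) (va i) (vb i) (N i - n) n (fun j => a j i)
        (fun j => b j i) → n < N i → RankEquiv (F i) (va i) (vb i) (N i - (n + 1)) (n + 1)
          (Fin.snoc (fun j => a j i) (c i)) (Fin.snoc (fun j => b j i) e) := fun i => by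
      by_cases hi : n < N i
      · rw [show N i - n = N i - (n + 1) + 1 by omega]
        by_cases hab : RankEquiv (F i) (va i) (vb i) (N i - (n + 1) + 1) n (fun j => a j i)
          (fun j => b j i)
        · exact ((rankEquiv_succ.1 hab).2.1 (c i)).imp fun e he _ _ => he
        · exact ⟨Classical.arbitrary _, fun h => (hab h).elim⟩
      · exact ⟨Classical.arbitrary _, fun _ h => (hi h).elim⟩
    choose e he using step
    refine ⟨_, Fin.snoc a c, Fin.snoc b e, coe_snoc U a c, coe_snoc U b e, ?_⟩
    filter_upwards [h, hN n] with i hi hni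
    rw [snoc_apply_eq, snoc_apply_eq]
    exact he i hi hni
  back := by
    rintro n _ _ ⟨a, b, rfl, rfl, h⟩ e
    obtain ⟨e, rfl⟩ := Quotient.exists_rep e
    have step : ∀ i, ∃ c, RankEquiv (F i) (va i) (vb i) (N i - n) n (fun j => a j i)
        (fun j => b j i) → n < N i → RankEquiv (F i) (va i) (vb i) (N i - (n + 1)) (n + 1)
          (Fin.snoc (fun j => a j i) c) (Fin.snoc (fun j => b j i) (e i)) := fun i => by
      by_cases hi : n < N i
      · rw [show N i - n = N i - (n + 1) + 1 by omega]
        by_cases hab : RankEquiv (F i) (va i) (vb i) (N i - (n + 1) + 1) n (fun j => a j i)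
          (fun j => b j i)
        · exact ((rankEquiv_succ.1 hab).2.2 (e i)).imp fun c hc _ _ => hc
        · exact ⟨Classical.arbitrary _, fun h => (hab h).elim⟩
      · exact ⟨Classical.arbitrary _, fun _ h => (hi h).elim⟩
    choose c hc using step
    refine ⟨_, Fin.snoc a c, Fin.snoc b e, coe_snoc U a c, coe_snoc U b e, ?_⟩
    filter_upwards [h, hN n] with i hi hni
    rw [snoc_apply_eq, snoc_apply_eq]
    exact hc i hi hni
  rel := by
    rintro n _ _ ⟨a, b, rfl, rfl, h⟩ k r ts
    refine (Ultraproduct.boundedFormula_realize_cast (u := U) (BoundedFormula.rel r ts)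
      (fun p i => va i p) a).trans (Iff.trans ?_
        (Ultraproduct.boundedFormula_realize_cast (u := U) (BoundedFormula.rel r ts)
          (fun p i => vb i p) b).symm)
    refine Filter.eventually_congr ?_
    filter_upwards [h, hF n (BoundedFormula.rel r ts)] with i hi hri
    exact rankEquiv_zero.1 hi.zero _ hri trivial

end Ultraproduct

/-- A formula only depends on the values of its free variables, which can be listed. -/
theorem exists_restrict_realize (ψ : L.Formula α) :
    ∃ (m : ℕ) (e : Fin m → α) (ρ : α → Fin m), ∀ {M : Type (max u v)} [L.Structure M] (v : α → M),
      ψ.Realize (v ∘ e ∘ ρ) ↔ ψ.Realize v := by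
  classical
  obtain ⟨s, hs, hne⟩ : ∃ s : Finset α, ψ.freeVarFinset ⊆ s ∧ (Nonempty α → s.Nonempty) := by
    rcases isEmpty_or_nonempty α with h | ⟨⟨a⟩⟩
    · exact ⟨_, subset_rfl, fun h' => (not_isEmpty_iff.2 h' h).elim⟩
    · exact ⟨insert a ψ.freeVarFinset, Finset.subset_insert _ _, fun _ => by simp⟩
  have hρ : ∃ ρ : α → s, ∀ a ∈ s, (ρ a : α) = a := by
    refine ⟨fun a => if h : a ∈ s then ⟨a, h⟩ else ⟨_, (hne ⟨a⟩).choose_spec⟩, fun a ha => ?_⟩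
    simp [ha]
  obtain ⟨ρ, hρ⟩ := hρ
  refine ⟨s.card, fun i => s.equivFin.symm i, fun a => s.equivFin (ρ a), fun v => ?_⟩
  have hv : (v ∘ (fun i => (s.equivFin.symm i : α)) ∘ fun a => s.equivFin (ρ a)) ∘
      (Subtype.val : ↥(s : Set α) → α) = v ∘ Subtype.val := by
    funext a
    simp [hρ a.1 (Finset.mem_coe.1 a.2)]
  have hs' : (ψ.freeVarFinset : Set α) ⊆ s := Finset.coe_subset.2 hs
  rw [Formula.Realize, Formula.Realize, ← BoundedFormula.realize_restrictFreeVar' hs', hv,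
    BoundedFormula.realize_restrictFreeVar' hs']

/-- Back-and-forth equivalent structures that are strict quotients of term models agree on a formula
whose star translation is equivalent to a formula without `E`. -/
theorem BackForth.realize_iff_of_star {ψ : L.Formula α} {Γ : L.Theory}
    {μ : (L.sum eLang).Formula α} (hμ : EFree μ)
    (hμψ : ∀ (M : Type (max u v)) (S' : (L.sum eLang).Structure M), Nonempty M →
      (∀ γ ∈ Γ, @Sentence.Realize (L.sum eLang) M S' (star γ)) →
      IsCongruence L (@LHom.reduct L (L.sum eLang) LHom.sumInl M S') (interpE S') →
      ∀ v : α → M, @Formula.Realize (L.sum eLang) M S' α (star ψ) v ↔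
        @Formula.Realize (L.sum eLang) M S' α μ v)
    {P : Type} {A B : Type (max u v)} [L.Structure A] [L.Structure B] [Nonempty A] [Nonempty B]
    (hA : A ⊨ Γ) (hB : B ⊨ Γ) {va : P → A} {vb : P → B}
    {I : ∀ n, (Fin n → A) → (Fin n → B) → Prop} (h : BackForth L va vb I)
    (h₀ : I 0 Fin.elim0 Fin.elim0) (ρ : α → P) :
    ψ.Realize (va ∘ ρ) ↔ ψ.Realize (vb ∘ ρ) := by
  have star_iff : ∀ {A : Type (max u v)} [L.Structure A] [Nonempty A] (_ : A ⊨ Γ) (va : P → A),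
      ψ.Realize (va ∘ ρ) ↔ @Formula.Realize _ _ (termStructure (evalVar va)) _ μ
        (fun a => (Term.var (Sum.inl (ρ a)) : L.Term (P ⊕ A × ℕ))) := by
    intro A _ _ hA va
    let := termStructure (L := L) (evalVar va)
    have hev : Function.Surjective (evalVar va) := fun a => ⟨Sum.inr (a, 0), rfl⟩
    have hπ := termStructure_isStrictQuotient (L := L) hev
    rw [← hμψ _ _ ⟨Term.var (Sum.inr (Classical.arbitrary A, 0))⟩ (fun γ hγ => ?_) hπ.isCongruence]
    · refine Iff.symm ((hπ.realize_star ψ _ _).trans (iff_of_eq ?_))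
      exact congrArg _ (Subsingleton.elim _ _)
    · refine (hπ.realize_star γ _ _).2 ?_
      convert! hA.realize_of_mem γ hγ using 1
      exact iff_of_eq (congrArg₂ _ (Subsingleton.elim _ _) (Subsingleton.elim _ _))
  rw [star_iff hA va, star_iff hB vb]
  refine h.realize_iff hμ (x := Fin.elim0) (y := Fin.elim0)
    ⟨fun i => i.elim0, fun i => i.elim0, ?_⟩ (fun a => ⟨Term.var (Sum.inl (ρ a)), rfl, rfl⟩)
    (fun j => j.elim0)
  convert! h₀ using 1

/-- If no equality-free formula is equivalent to `ψ` modulo `Γ`, then there are models of `Γ` that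
disagree on `ψ` and cannot be told apart by `N` rounds of the back-and-forth game. -/
theorem exists_rankEquiv_of_forall_not_equivalent {ψ : L.Formula α} {Γ : L.Theory}
    (hψ : ¬ ∃ φ : L.Formula α, EqualityFree φ ∧
      ∀ (M : Type (max u v)) (S : L.Structure M), Nonempty M → @Theory.Model L M S Γ →
        ∀ v : α → M, @Formula.Realize L M S α ψ v ↔ @Formula.Realize L M S α φ v)
    {P : Type} (e : P → α) (ρ : α → P)
    (hρ : ∀ {M : Type (max u v)} [L.Structure M] (v : α → M),
      ψ.Realize (v ∘ e ∘ ρ) ↔ ψ.Realize v)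
    (F : Finset (Σ n, L.BoundedFormula P n)) (N : ℕ) :
    ∃ (A B : Type (max u v)) (_ : L.Structure A) (_ : L.Structure B) (va : P → A) (vb : P → B),
      Nonempty A ∧ Nonempty B ∧ A ⊨ Γ ∧ B ⊨ Γ ∧ RankEquiv F va vb N 0 Fin.elim0 Fin.elim0 ∧
        ψ.Realize (va ∘ ρ) ∧ ¬ ψ.Realize (vb ∘ ρ) := by
  classical
  obtain ⟨Δ, hΔ, hrank⟩ := exists_finset_rankEquiv.{u, v, max u v, 0} F N 0
  by_contra hne
  let good : Set (Finset (L.BoundedFormula P 0)) := {T | T ∈ Δ.powerset ∧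
    ∃ (A : Type (max u v)) (_ : L.Structure A) (va : P → A), Nonempty A ∧ A ⊨ Γ ∧
      ψ.Realize (va ∘ ρ) ∧ T = trueFormulas Δ va Fin.elim0}
  have : Finite good := (Δ.powerset.finite_toSet.subset fun T hT => hT.1).to_subtype
  let φ : L.BoundedFormula P 0 := BoundedFormula.iSup fun T : good => typeFormula Δ T.1
  refine hψ ⟨φ.subst (Term.var ∘ e),
    equalityFree_subst _ (equalityFree_iSup fun T => equalityFree_typeFormula hΔ),
    fun M S hM hΓ v => ?_⟩
  have hφ : Formula.Realize (φ.subst (Term.var ∘ e)) v ↔ φ.Realize (v ∘ e) Fin.elim0 := by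
    rw [Formula.Realize, BoundedFormula.realize_subst]
    exact iff_of_eq (congrArg _ (Subsingleton.elim _ _))
  rw [hφ, BoundedFormula.realize_iSup, ← hρ v]
  constructor
  · intro hv
    exact ⟨⟨trueFormulas Δ (v ∘ e) Fin.elim0, Finset.mem_powerset.2 (Finset.filter_subset _ _),
      M, S, v ∘ e, hM, hΓ, hv, rfl⟩, realize_typeFormula_trueFormulas.2 fun _ _ => Iff.rfl⟩
  · rintro ⟨⟨T, _, A, SA, va, hA, hAΓ, hva, rfl⟩, hT⟩
    by_contra hv
    exact hne ⟨A, M, SA, S, va, v ∘ e, hA, hM, hAΓ, hΓ,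
      hrank A M va (v ∘ e) _ _ (realize_typeFormula_trueFormulas.1 hT), hva, hv⟩

end ElimEq

/-- **Eliminating equality via a congruence symbol.**
Let `ψ` be a formula and `Γ` a finite set of sentences over `L` (possibly using equality).
The following are equivalent:
(i) there is an equality-free `L`-formula `φ` equivalent to `ψ` modulo `Th(Γ)`
(on all nonempty models of `Γ`);
(ii) there is a formula `μ` over `L.sum eLang` not using the fresh binary relation symbol `E`
that is equivalent to `ψ*` modulo `Th(Γ* ∪ {δ_E})`, i.e. on all (nonempty) structures for the
extended language satisfying the star translations of all sentences of `Γ` and interpreting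
`E` as a congruence with respect to all symbols of `L`. -/
theorem equalityFree_equivalent_iff_eFree_equivalent_star
    (ψ : L.Formula α) (Γ : L.Theory) (hΓ : Γ.Finite) :
    (∃ φ : L.Formula α, EqualityFree φ ∧
        ∀ (M : Type (max u v)) (S : L.Structure M), Nonempty M →
          @Theory.Model L M S Γ →
          ∀ v : α → M, @Formula.Realize L M S α ψ v ↔ @Formula.Realize L M S α φ v) ↔
      (∃ μ : (L.sum eLang).Formula α, EFree μ ∧
        ∀ (M : Type (max u v)) (S' : (L.sum eLang).Structure M), Nonempty M →
          (∀ γ ∈ Γ, @Sentence.Realize (L.sum eLang) M S' (star γ)) →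
          IsCongruence L (@LHom.reduct L (L.sum eLang) LHom.sumInl M S') (interpE S') →
          ∀ v : α → M,
            @Formula.Realize (L.sum eLang) M S' α (star ψ) v ↔
              @Formula.Realize (L.sum eLang) M S' α μ v) := by
  constructor
  · rintro ⟨φ, hφ, h⟩
    refine ⟨star φ, ElimEq.eFree_star hφ, fun M S' hM hΓ' hE v => ?_⟩
    let := quotientStructureOf (@LHom.reduct L (L.sum eLang) LHom.sumInl M S') ⟨_, hE.1⟩
    have hπ := ElimEq.quotient_isStrictQuotient S' hE
    refine (hπ.realize_star ψ _ _).trans (Iff.trans ?_ (hπ.realize_star φ _ _).symm)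
    rw [Subsingleton.elim (Quotient.mk _ ∘ (default : Fin 0 → M)) default]
    refine h _ _ (hM.map (Quotient.mk _)) ⟨fun γ hγ => ?_⟩ _
    have hγ' := (hπ.realize_star γ _ _).1 (hΓ' γ hγ)
    rwa [Subsingleton.elim (Quotient.mk _ ∘ (default : Fin 0 → M)) default,
      Subsingleton.elim (Quotient.mk _ ∘ (default : Empty → M)) default] at hγ'
  · rintro ⟨μ, hμ, hμψ⟩
    by_contra hψ
    obtain ⟨m, e, ρ, hρ⟩ := ElimEq.exists_restrict_realize ψ
    choose A B SA SB va vb hA hB hAΓ hBΓ hAB hva hvb using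
      fun i : ℕ × Finset (Σ n, L.BoundedFormula (Fin m) n) =>
        ElimEq.exists_rankEquiv_of_forall_not_equivalent hψ e ρ hρ i.2 i.1
    classical
    let U : Ultrafilter (ℕ × Finset (Σ n, L.BoundedFormula (Fin m) n)) :=
      Ultrafilter.of Filter.atTop
    have hU : (U : Filter (ℕ × Finset (Σ n, L.BoundedFormula (Fin m) n))) ≤ Filter.atTop :=
      Ultrafilter.of_le _
    have hbf := ElimEq.ultraRankEquiv_backForth U (F := Prod.snd) (N := Prod.fst)
      (fun n θ => hU ((Filter.eventually_ge_atTop (0, {⟨n, θ⟩})).mono fun i hi =>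
        hi.2 (Finset.mem_singleton_self _)))
      (fun n => hU ((Filter.eventually_ge_atTop (n + 1, ∅)).mono fun i hi => hi.1)) va vb
    have hiff := ElimEq.BackForth.realize_iff_of_star hμ hμψ
      ⟨fun γ hγ => (Ultraproduct.sentence_realize γ).2
        (.of_forall fun i => (hAΓ i).realize_of_mem γ hγ)⟩
      ⟨fun γ hγ => (Ultraproduct.sentence_realize γ).2
        (.of_forall fun i => (hBΓ i).realize_of_mem γ hγ)⟩ hbf
      ⟨fun j => j.elim0, fun j => j.elim0, Subsingleton.elim _ _, Subsingleton.elim _ _,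
        .of_forall fun i => by
          convert! hAB i using 1⟩ ρ
    have hAψ := (Ultraproduct.realize_formula_cast (u := U) ψ fun a i => va i (ρ a)).2
      (.of_forall hva)
    have hBψ := (Ultraproduct.realize_formula_cast (u := U) ψ fun a i => vb i (ρ a)).1
      (hiff.1 hAψ)
    obtain ⟨i, hi⟩ := hBψ.exists
    exact hvb i hi
end
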